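/- arXiv:0801.3260 — 2 statements merged into one kernel-verified Lean document; each statement's English description precedes it below -/
import Mathlib

section
/- (Left rationality and coassociativity.) Let (V, Y, c) be a graded vertex coalgebra over F, v' ∈ (V^{⊗3})' and v ∈ V. Then: (a) the formal series ⟨v', (Y(x_0) ⊗ Id_V)Y(x_2)v⟩ lies in F[x_0^{-1}, x_2][[x_0, x_2^{-1}]] and equals ι_{20} k(x_0,x_2) for a uniquely determined rational function k ∈ F[x_0,x_2]_S of the form k(x_0,x_2) = h(x_0,x_2)/(x_0^r x_2^s (x_0+x_2)^t) with h ∈ F[x_0,x_2] and r,s,t ∈ ℤ; and (b) ι_{12}^{-1}⟨v', (Id_V ⊗ Y(x_2))Y(x_1)v⟩ = (ι_{20}^{-1}⟨v', (Y(x_0) ⊗ Id_V)Y(x_2)v⟩)|_{x_0 = x_1 − x_2} as rational functions. -/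
/- Common background for the formalization of "Vertex coalgebras, comodules,
cocommutativity and coassociativity" (K. Hubbard).

A vertex coalgebra `(V, Y, c)` is encoded by the family of coefficient maps
`Δ k : V →ₗ V ⊗ V` of the coproduct `Y(x)v = ∑ₖ Δ k v · x^(-k-1)` together with
the covacuum `c : V →ₗ F`.  All identities of formal series are encoded
coefficient-wise; in particular the Jacobi identity is encoded by its
(dual Borcherds) coefficient form. -/

noncomputable section

open scoped TensorProduct

variable (F : Type) [Field F] [CharZero F]

/-- The generalized binomial coefficient `(a choose i)` as an element of `F`. -/
def gchoose (a : ℤ) (i : ℕ) : F :=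
  (∏ j ∈ Finset.range i, ((a : F) - (j : F))) / (Nat.factorial i : F)

variable {V M : Type} [AddCommGroup V] [Module F V] [AddCommGroup M] [Module F M]

/-- `c ⊗ Id` composed with the canonical identification `F ⊗ M ≃ M`. -/
def cLeft (c : V →ₗ[F] F) : V ⊗[F] M →ₗ[F] M :=
  (TensorProduct.lid F M).toLinearMap ∘ₗ TensorProduct.map c LinearMap.id

/-- `Id ⊗ c` composed with the canonical identification `V ⊗ F ≃ V`. -/
def cRight (c : M →ₗ[F] F) : V ⊗[F] M →ₗ[F] V :=
  (TensorProduct.rid F V).toLinearMap ∘ₗ TensorProduct.map LinearMap.id c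

/-- The transposition `T ⊗ Id` of the first two tensor factors of `V ⊗ (V ⊗ M)`. -/
def Tfirst : V ⊗[F] (V ⊗[F] M) →ₗ[F] V ⊗[F] (V ⊗[F] M) :=
  (TensorProduct.assoc F V V M).toLinearMap ∘ₗ
    TensorProduct.map (TensorProduct.comm F V V).toLinearMap LinearMap.id ∘ₗ
    (TensorProduct.assoc F V V M).symm.toLinearMap

/-- The coefficient of `x₁^(-m-1) x₂^(-n-1)` in `(Id ⊗ Y(x₂)) Y(x₁)`. -/
def comp12 (ΔM : ℤ → M →ₗ[F] V ⊗[F] M) (m n : ℤ) : M →ₗ[F] V ⊗[F] (V ⊗[F] M) :=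
  TensorProduct.map LinearMap.id (ΔM n) ∘ₗ ΔM m

/-- The coefficient of `x₀^(-m-1) x₂^(-n-1)` in `(Y(x₀) ⊗ Id) Y(x₂)`. -/
def compR (ΔV : ℤ → V →ₗ[F] V ⊗[F] V) (ΔM : ℤ → M →ₗ[F] V ⊗[F] M) (m n : ℤ) :
    M →ₗ[F] V ⊗[F] (V ⊗[F] M) :=
  (TensorProduct.assoc F V V M).toLinearMap ∘ₗ TensorProduct.map (ΔV m) LinearMap.id ∘ₗ ΔM n

/-- The coefficient form of the (comodule) Jacobi identity of a vertex coalgebra,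
obtained by extracting the coefficient of `x₀^(-a-1) x₁^(-b-1) x₂^(-c-1)`. -/
def JacobiId (ΔV : ℤ → V →ₗ[F] V ⊗[F] V) (ΔM : ℤ → M →ₗ[F] V ⊗[F] M) : Prop :=
  ∀ (a b c : ℤ) (w : M),
    (∑ᶠ i : ℕ, ((-1 : F) ^ i * gchoose F a i) •
        (comp12 F ΔM (a + b - i) (c + i) w -
          (-1 : F) ^ a • Tfirst F (comp12 F ΔM (a + c - i) (b + i) w))) =
      ∑ᶠ i : ℕ, gchoose F b i • compR F ΔV ΔM (a + i) (b + c - i) w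

/-- The axioms of a vertex coalgebra except the Jacobi identity: left counit,
cocreation and truncation, in coefficient form. -/
def IsVertexCoalgSansJacobi (Δ : ℤ → V →ₗ[F] V ⊗[F] V) (c : V →ₗ[F] F) : Prop :=
  (∀ v : V, cLeft F c (Δ (-1) v) = v) ∧
  (∀ k : ℤ, k ≠ -1 → ∀ v : V, cLeft F c (Δ k v) = 0) ∧
  (∀ v : V, cRight F c (Δ (-1) v) = v) ∧
  (∀ k : ℤ, 0 ≤ k → ∀ v : V, cRight F c (Δ k v) = 0) ∧
  (∀ v : V, ∃ N : ℤ, ∀ k : ℤ, k < N → Δ k v = 0)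

/-- The axioms of a vertex coalgebra. -/
def IsVertexCoalg (Δ : ℤ → V →ₗ[F] V ⊗[F] V) (c : V →ₗ[F] F) : Prop :=
  IsVertexCoalgSansJacobi F Δ c ∧ JacobiId F Δ Δ

/-- The weight-`m` component of `V ⊗ V` for a graded space `V`. -/
def grT2 (gr : ℤ → Submodule F V) (m : ℤ) : Submodule F (V ⊗[F] V) :=
  ⨆ p : ℤ, LinearMap.range (TensorProduct.map (gr p).subtype (gr (m - p)).subtype)

/-- The weight-`m` component of `V ⊗ (V ⊗ V)` for a graded space `V`. -/
def grT3 (gr : ℤ → Submodule F V) (m : ℤ) : Submodule F (V ⊗[F] (V ⊗[F] V)) :=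
  ⨆ p : ℤ × ℤ, LinearMap.range (TensorProduct.map (gr p.1).subtype
    (TensorProduct.map (gr p.2).subtype (gr (m - p.1 - p.2)).subtype))

/-- The grading axioms of a graded vertex coalgebra: `V = ⊕ₖ V₍ₖ₎` internally,
`V₍ₖ₎ = 0` for `k` sufficiently small, and `Δ k` raises weight by `k + 1`. -/
def IsGradedVC (Δ : ℤ → V →ₗ[F] V ⊗[F] V) (gr : ℤ → Submodule F V) : Prop :=
  DirectSum.IsInternal gr ∧ (∃ N : ℤ, ∀ k : ℤ, k < N → gr k = ⊥) ∧
  (∀ r k : ℤ, ∀ v ∈ gr r, Δ k v ∈ grT2 F gr (r + k + 1))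

/-- `f` belongs to the graded dual `(V^{⊗3})'`: it vanishes on all but finitely
many homogeneous components of `V ⊗ V ⊗ V`. -/
def GradedDual3 (gr : ℤ → Submodule F V) (f : V ⊗[F] (V ⊗[F] V) →ₗ[F] F) : Prop :=
  ∃ s : Finset ℤ, ∀ m : ℤ, m ∉ s → ∀ u ∈ grT3 F gr m, f u = 0

/-- The weight-`q` component of `V ⊗ M` for `V` a `ℤ`-graded space and
`M` a `ℚ`-graded space. -/
def grVM (gr : ℤ → Submodule F V) (grM : ℚ → Submodule F M) (q : ℚ) :
    Submodule F (V ⊗[F] M) :=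
  ⨆ p : ℤ, LinearMap.range (TensorProduct.map (gr p).subtype (grM (q - p)).subtype)

/-- The weight-`q` component of `V ⊗ (V ⊗ M)`. -/
def grVVM (gr : ℤ → Submodule F V) (grM : ℚ → Submodule F M) (q : ℚ) :
    Submodule F (V ⊗[F] (V ⊗[F] M)) :=
  ⨆ p : ℤ × ℤ, LinearMap.range (TensorProduct.map (gr p.1).subtype
    (TensorProduct.map (gr p.2).subtype (grM (q - p.1 - p.2)).subtype))

/-- `f` belongs to the graded dual `(V ⊗ V ⊗ M)'`. -/
def GradedDualVVM (gr : ℤ → Submodule F V) (grM : ℚ → Submodule F M)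
    (f : V ⊗[F] (V ⊗[F] M) →ₗ[F] F) : Prop :=
  ∃ s : Finset ℚ, ∀ q : ℚ, q ∉ s → ∀ u ∈ grVVM F gr grM q, f u = 0

/-- The axioms of a comodule over a graded vertex coalgebra, except the Jacobi
identity: left counit, truncation, internal `ℚ`-grading bounded below, and the
grading condition on the comodule coproduct. -/
def IsComoduleSansJacobi (c : V →ₗ[F] F) (ΔM : ℤ → M →ₗ[F] V ⊗[F] M)
    (gr : ℤ → Submodule F V) (grM : ℚ → Submodule F M) : Prop :=
  (∀ w : M, cLeft F c (ΔM (-1) w) = w) ∧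
  (∀ k : ℤ, k ≠ -1 → ∀ w : M, cLeft F c (ΔM k w) = 0) ∧
  (∀ w : M, ∃ N : ℤ, ∀ k : ℤ, k < N → ΔM k w = 0) ∧
  DirectSum.IsInternal grM ∧ (∃ N : ℚ, ∀ q : ℚ, q < N → grM q = ⊥) ∧
  (∀ (j : ℚ) (k : ℤ), ∀ w ∈ grM j, ΔM k w ∈ grVM F gr grM (j + k + 1))

/-- Weak cocommutativity with exponent `k`, paired against `f`, coefficient-wise:
the coefficient of `x₁^(-b-1) x₂^(-c-1)` in
`(x₁-x₂)^k ⟨f, (Id ⊗ Y(x₂))Y(x₁)w - (T ⊗ Id)(Id ⊗ Y(x₁))Y(x₂)w⟩` vanishes. -/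
def WeakCocom (ΔM : ℤ → M →ₗ[F] V ⊗[F] M) (f : V ⊗[F] (V ⊗[F] M) →ₗ[F] F)
    (k : ℕ) : Prop :=
  ∀ (w : M) (b c : ℤ),
    ∑ j ∈ Finset.range (k + 1), ((-1 : F) ^ j * (k.choose j : F)) *
      (f (comp12 F ΔM (b + k - j) (c + j) w) -
        f (Tfirst F (comp12 F ΔM (c + j) (b + k - j) w))) = 0

/-- Weak coassociativity with exponent `k`, paired against `f`, coefficient-wise:
the coefficient of `x₀^(-a-1) x₂^(-c-1)` in
`(x₀+x₂)^k ⟨f, (Y(x₀) ⊗ Id)Y(x₂)w - (Id ⊗ Y(x₂))Y(x₀+x₂)w⟩` vanishes,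
`Y(x₀+x₂)` being expanded in nonnegative integral powers of `x₂`. -/
def WeakCoassoc (ΔV : ℤ → V →ₗ[F] V ⊗[F] V) (ΔM : ℤ → M →ₗ[F] V ⊗[F] M)
    (f : V ⊗[F] (V ⊗[F] M) →ₗ[F] F) (k : ℕ) : Prop :=
  ∀ (w : M) (a c : ℤ),
    ∑ j ∈ Finset.range (k + 1), (k.choose j : F) *
      (f (compR F ΔV ΔM (a + k - j) (c + j) w) -
        ∑ᶠ i : ℕ, ((-1 : F) ^ i * gchoose F (a + k - j) i) *
          f (comp12 F ΔM (a + k - j - i) (c + j + i) w)) = 0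

/-- The coefficient function of `x^r y^s (x + ε y)^t · A`, where `A : ℤ → ℤ → F`
is the coefficient function of a formal series (`A m n` is the coefficient of
`x^m y^n`). -/
def mulPoly (r s t : ℕ) (ε : F) (A : ℤ → ℤ → F) (m n : ℤ) : F :=
  ∑ j ∈ Finset.range (t + 1), (t.choose j : F) * ε ^ j *
    A (m - (r : ℤ) - ((t - j : ℕ) : ℤ)) (n - (s : ℤ) - (j : ℤ))

/-- `g` is the coefficient function of a polynomial in two variables. -/
def IsPolyCoeff (g : ℤ → ℤ → F) : Prop :=
  {p : ℤ × ℤ | g p.1 p.2 ≠ 0}.Finite ∧ ∀ m n : ℤ, m < 0 ∨ n < 0 → g m n = 0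

/-- The coefficient function of the polynomial `h(x₁ - x₂, x₂)` in the
variables `x₁, x₂`, given the coefficient function of `h = h(x₀, x₂)`. -/
def substC (h : ℤ → ℤ → F) (m n : ℤ) : F :=
  ∑ᶠ j : ℕ, ((-1 : F) ^ j * gchoose F (m + j) j) * h (m + j) (n - j)

/-- The coefficient form of the Jacobi identity of a vertex algebra (the
Borcherds identity). -/
def VAJacobi (mul : ℤ → V →ₗ[F] V →ₗ[F] V) : Prop :=
  ∀ (a b c : ℤ) (u v w : V),
    (∑ᶠ i : ℕ, ((-1 : F) ^ i * gchoose F a i) •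
        (mul (a + b - i) u (mul (c + i) v w) -
          (-1 : F) ^ a • mul (a + c - i) v (mul (b + i) u w))) =
      ∑ᶠ i : ℕ, gchoose F b i • mul (b + c - i) (mul (a + i) u v) w

/-- The axioms of a vertex algebra: truncation, vacuum, creation and the Jacobi
identity, in coefficient form (`mul n u v` is `u_n v`). -/
def IsVA (mul : ℤ → V →ₗ[F] V →ₗ[F] V) (one : V) : Prop :=
  (∀ u v : V, ∃ N : ℤ, ∀ n : ℤ, N < n → mul n u v = 0) ∧
  (∀ v : V, mul (-1) one v = v) ∧
  (∀ n : ℤ, n ≠ -1 → ∀ v : V, mul n one v = 0) ∧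
  (∀ v : V, mul (-1) v one = v) ∧
  (∀ n : ℤ, 0 ≤ n → ∀ v : V, mul n v one = 0) ∧
  VAJacobi F mul

/-- The graded dual `V' = ⊕ₖ V₍ₖ₎*`, realized as the submodule of the full dual
consisting of functionals vanishing on all but finitely many components. -/
def gradedDual (gr : ℤ → Submodule F V) : Submodule F (Module.Dual F V) where
  carrier := {φ | ∃ s : Finset ℤ, ∀ k ∉ s, ∀ u ∈ gr k, φ u = 0}
  zero_mem' := ⟨∅, by intro k _ u _; simp⟩
  add_mem' := by
    rintro a b ⟨s, hs⟩ ⟨t, ht⟩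
    refine ⟨s ∪ t, ?_⟩
    intro k hk u hu
    simp only [Finset.mem_union, not_or] at hk
    simp [LinearMap.add_apply, hs k hk.1 u hu, ht k hk.2 u hu]
  smul_mem' := by
    rintro r a ⟨s, hs⟩
    refine ⟨s, ?_⟩
    intro k hk u hu
    simp [LinearMap.smul_apply, hs k hk u hu]

/-- The weight-`k` component `V₍ₖ₎* ⊆ V'` of the graded dual: functionals
vanishing on every component of weight other than `k`. -/
def gradedDualPiece (gr : ℤ → Submodule F V) (k : ℤ) :
    Submodule F ↥(gradedDual F gr) where
  carrier := {φ | ∀ j : ℤ, j ≠ k → ∀ u ∈ gr j, (φ : Module.Dual F V) u = 0}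
  zero_mem' := by intro j _ u _; simp
  add_mem' := by
    intro a b ha hb j hj u hu
    simp [ha j hj u hu, hb j hj u hu]
  smul_mem' := by
    intro r a ha j hj u hu
    simp [ha j hj u hu]

/-- The natural pairing of `V' ⊗ V'` with `V ⊗ V`. -/
def pairVV (gr : ℤ → Submodule F V) :
    ↥(gradedDual F gr) ⊗[F] ↥(gradedDual F gr) →ₗ[F] Module.Dual F (V ⊗[F] V) :=
  TensorProduct.dualDistrib F V V ∘ₗ
    TensorProduct.map (gradedDual F gr).subtype (gradedDual F gr).subtype

/-- The covacuum map on the graded dual: evaluation at the vacuum. -/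
def covac (gr : ℤ → Submodule F V) (one : V) : ↥(gradedDual F gr) →ₗ[F] F :=
  LinearMap.applyₗ one ∘ₗ (gradedDual F gr).subtype

/-- A bilinear form `B` on `V` extended componentwise to `V ⊗ V`. -/
def formT2 (B : V →ₗ[F] V →ₗ[F] F) : V ⊗[F] V →ₗ[F] Module.Dual F (V ⊗[F] V) :=
  TensorProduct.dualDistrib F V V ∘ₗ TensorProduct.map B B

theorem gchoose_eq_choose (a : ℤ) (i : ℕ) : gchoose F a i = ((Ring.choose a i : ℤ) : F) := by
  have h : ∏ j ∈ Finset.range i, (a - (j : ℤ)) = (i.factorial : ℤ) * Ring.choose a i := by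
    rw [← descPochhammer_eval_eq_prod_range, ← nsmul_eq_mul,
      ← Ring.descPochhammer_eq_factorial_smul_choose, ← Polynomial.aeval_eq_smeval,
      Polynomial.coe_aeval_eq_eval]
  have h' := congrArg (Int.cast : ℤ → F) h
  push_cast at h'
  rw [gchoose, h', mul_div_cancel_left₀]
  exact_mod_cast i.factorial_ne_zero

theorem gchoose_natCast (n i : ℕ) : gchoose F (n : ℤ) i = (n.choose i : F) := by
  simp [gchoose_eq_choose, Ring.choose_natCast]

theorem choose_eq_neg_one_pow_mul (a : ℤ) (k : ℕ) :
    Ring.choose a k = (-1) ^ k * Ring.choose ((k : ℤ) - 1 - a) k := by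
  have h := Ring.choose_neg (-a) k
  rw [neg_neg, Int.negOnePow_def, Units.smul_def] at h
  rw [h, smul_eq_mul]
  congr 2
  ring

/-- A form of the Vandermonde identity. -/
theorem sum_antidiagonal_choose_mul_choose (m r : ℤ) (k : ℕ) :
    ∑ p ∈ Finset.HasAntidiagonal.antidiagonal k,
      Ring.choose (m + p.1) p.1 * Ring.choose (r - 1 - m - p.1) p.2 = Ring.choose r k := by
  have hV := Ring.add_choose_eq k (Commute.all (-m - 1) (m + k - r))
  rw [choose_eq_neg_one_pow_mul r k,
    show (k : ℤ) - 1 - r = (-m - 1) + (m + k - r) by ring, hV, Finset.mul_sum]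
  refine Finset.sum_congr rfl fun p hp => ?_
  obtain rfl : p.1 + p.2 = k := by simpa using hp
  rw [choose_eq_neg_one_pow_mul (m + p.1), choose_eq_neg_one_pow_mul (r - 1 - m - p.1), pow_add,
    show (p.1 : ℤ) - 1 - (m + p.1) = -m - 1 by ring,
    show (p.2 : ℤ) - 1 - (r - 1 - m - p.1) = m + ((p.1 + p.2 : ℕ) : ℤ) - r by push_cast; ring]
  ring

theorem sum_antidiagonal_gchoose_mul_gchoose (m r : ℤ) (k : ℕ) :
    ∑ p ∈ Finset.HasAntidiagonal.antidiagonal k,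
      gchoose F (m + p.1) p.1 * gchoose F (r - 1 - m - p.1) p.2 = gchoose F r k := by
  simp only [gchoose_eq_choose]
  exact_mod_cast congrArg (Int.cast : ℤ → F) (sum_antidiagonal_choose_mul_choose m r k)

omit [CharZero F] in
theorem mulPoly_comm (r s t r' s' t' : ℕ) (ε ε' : F) (A : ℤ → ℤ → F) (m n : ℤ) :
    mulPoly F r s t ε (mulPoly F r' s' t' ε' A) m n =
      mulPoly F r' s' t' ε' (mulPoly F r s t ε A) m n := by
  simp only [mulPoly, Finset.mul_sum]
  rw [Finset.sum_comm]
  refine Finset.sum_congr rfl fun i _ => Finset.sum_congr rfl fun j _ => ?_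
  rw [sub_right_comm _ (r' : ℤ), sub_right_comm n (s : ℤ) (j : ℤ)]
  ring_nf

theorem finsum_eq_sum_range {N : Type*} [AddCommMonoid N] {g : ℕ → N} {L : ℕ}
    (hg : ∀ i, L ≤ i → g i = 0) : ∑ᶠ i, g i = ∑ i ∈ Finset.range L, g i := by
  refine finsum_eq_sum_of_support_subset _ fun i hi => ?_
  by_contra h
  exact hi (hg i (by simpa using h))

/-- The coefficients of the numerator in terms of those of `(Y(x₀) ⊗ Id)Y(x₂)`. -/
theorem mulPoly_one_eq_sum (R : ℤ → ℤ → F) (r s t : ℕ) (m n : ℤ) :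
    mulPoly F r s t 1 (fun m n => R (-m - 1) (-n - 1)) m n =
      ∑ i ∈ Finset.range (t + 1), gchoose F t i * R (r - 1 - m + i) (t + (s - n - 1) - i) := by
  rw [mulPoly, ← Finset.sum_range_reflect]
  refine Finset.sum_congr rfl fun i hi => ?_
  have hi' : i ≤ t := by simpa [Nat.lt_succ_iff] using hi
  have e : t + 1 - 1 - i = t - i := by omega
  rw [e, Nat.choose_symm hi', gchoose_natCast, one_pow, mul_one, Nat.sub_sub_self hi',
    Nat.cast_sub hi']
  congr 2 <;> ring

/-- The double series in the substitution `x₀ = x₁ - x₂` collapses by Vandermonde. -/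
theorem sum_gchoose_vandermonde (p : ℕ → F) (m r : ℤ) (L : ℕ) :
    ∑ j ∈ Finset.range L, ((-1 : F) ^ j * gchoose F (m + j) j) *
      ∑ i ∈ Finset.range (L - j), ((-1 : F) ^ i * gchoose F (r - 1 - m - j) i) * p (j + i) =
    ∑ k ∈ Finset.range L, ((-1 : F) ^ k * gchoose F r k) * p k := by
  simp only [Finset.mul_sum]
  rw [← Finset.sum_range_diag_flip L fun j i => ((-1 : F) ^ j * gchoose F (m + j) j) *
      (((-1 : F) ^ i * gchoose F (r - 1 - m - j) i) * p (j + i))]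
  refine Finset.sum_congr rfl fun k _ => ?_
  rw [← Finset.Nat.sum_antidiagonal_eq_sum_range_succ (fun j i =>
      ((-1 : F) ^ j * gchoose F (m + j) j) *
        (((-1 : F) ^ i * gchoose F (r - 1 - m - j) i) * p (j + i))) k,
    ← sum_antidiagonal_gchoose_mul_gchoose F m r k, Finset.mul_sum, Finset.sum_mul]
  refine Finset.sum_congr rfl fun q hq => ?_
  obtain rfl : q.1 + q.2 = k := by simpa using hq
  ring

section Scalar

variable {F} {P Q R : ℤ → ℤ → F} {B : ℕ}
  (hP : ∀ m n : ℤ, m < -B ∨ m + n < -B ∨ B < m + n → P m n = 0)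
  (hQ : ∀ m n : ℤ, m < -B ∨ m + n < -B ∨ B < m + n → Q m n = 0)
  (hR : ∀ m n : ℤ, n < -B ∨ m + n < -B ∨ B < m + n → R m n = 0)
  (hJ : ∀ a b c : ℤ,
    ∑ᶠ i : ℕ, ((-1 : F) ^ i * gchoose F a i) *
        (P (a + b - i) (c + i) - (-1 : F) ^ a * Q (a + c - i) (b + i)) =
      ∑ᶠ i : ℕ, gchoose F b i * R (a + i) (b + c - i))

include hQ hJ in
/-- Weak coassociativity from the Jacobi identity. -/
theorem weakCoassoc_of_jacobi {t : ℕ} (ht : 2 * B < t) (a c : ℤ) :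
    ∑ i ∈ Finset.range (t + 1), gchoose F t i * R (a + i) (t + c - i) =
      ∑ᶠ i : ℕ, ((-1 : F) ^ i * gchoose F a i) * P (a + t - i) (c + i) := by
  rw [← finsum_eq_sum_range, ← hJ]
  · refine finsum_congr fun i => ?_
    rw [hQ _ _ (by omega), mul_zero, sub_zero]
  · intro i hi
    rw [gchoose_natCast, Nat.choose_eq_zero_of_lt (by omega), Nat.cast_zero, zero_mul]

include hP hQ hR hJ in
theorem isPolyCoeff_mulPoly_of_jacobi {r s t : ℕ} (hr : 2 * B < r) (hs : 2 * B < s)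
    (ht : 2 * B < t) :
    IsPolyCoeff F (mulPoly F r s t 1 fun m n => R (-m - 1) (-n - 1)) := by
  have hneg : ∀ m n : ℤ, m < 0 ∨ n < 0 →
      mulPoly F r s t 1 (fun m n => R (-m - 1) (-n - 1)) m n = 0 := by
    rintro m n (h | h) <;> rw [mulPoly_one_eq_sum]
    · exact Finset.sum_eq_zero fun i _ => by rw [hR _ _ (by omega), mul_zero]
    · rw [weakCoassoc_of_jacobi hQ hJ ht]
      exact finsum_eq_zero_of_forall_eq_zero fun i => by rw [hP _ _ (by omega), mul_zero]
  refine ⟨(Set.finite_Icc ((0, 0) : ℤ × ℤ) (r + s + t + B, r + s + t + B)).subset ?_, hneg⟩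
  rintro ⟨m, n⟩ hmn
  have hm : 0 ≤ m ∧ 0 ≤ n := by
    by_contra h
    exact hmn (hneg m n (by omega))
  have hd : m + n ≤ r + s + t + B := by
    by_contra h
    refine hmn ?_
    simp only [mulPoly_one_eq_sum]
    exact Finset.sum_eq_zero fun i _ => by rw [hR _ _ (by omega), mul_zero]
  simp only [Set.mem_Icc, Prod.mk_le_mk]
  omega

include hP hQ hJ in
theorem mulPoly_eq_substC_of_jacobi {r s t : ℕ} (ht : 2 * B < t) (m n : ℤ) :
    mulPoly F t s r (-1) (fun m n => P (-m - 1) (-n - 1)) m n =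
      substC F (mulPoly F r s t 1 fun m n => R (-m - 1) (-n - 1)) m n := by
  obtain ⟨L, hrL, hL⟩ : ∃ L : ℕ, r + 1 ≤ L ∧ r - 1 - m + t - L < -B :=
    ⟨r + 1 + (r - 1 - m + t + B + 1).toNat, by omega, by omega⟩
  have hh : ∀ j : ℕ, mulPoly F r s t 1 (fun m n => R (-m - 1) (-n - 1)) (m + j) (n - j) =
      ∑ i ∈ Finset.range (L - j), ((-1 : F) ^ i * gchoose F (r - 1 - m - j) i) *
        P (r - 1 - m + t - (j + i : ℕ)) (s - n - 1 + (j + i : ℕ)) := by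
    intro j
    rw [mulPoly_one_eq_sum, weakCoassoc_of_jacobi hQ hJ ht, ← finsum_eq_sum_range]
    · refine finsum_congr fun i => ?_
      congr 2 <;> push_cast <;> ring_nf
    · intro i hi
      rw [hP _ _ (by omega), mul_zero]
  rw [substC, finsum_eq_sum_range (L := L)]
  · simp only [hh]
    rw [sum_gchoose_vandermonde F (fun k => P (r - 1 - m + t - k) (s - n - 1 + k)), mulPoly]
    refine Finset.sum_subset_zero_on_sdiff (by simpa using hrL) ?_ ?_
    · intro k hk
      rw [gchoose_natCast, Nat.choose_eq_zero_of_lt (by simp at hk; omega)]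
      simp
    · intro k hk
      have hk' : k ≤ r := by simpa [Nat.lt_succ_iff] using hk
      rw [gchoose_natCast, mul_comm ((-1 : F) ^ k), Nat.cast_sub hk']
      congr 2 <;> ring
  · intro j hj
    rw [hh, Nat.sub_eq_zero_of_le hj]
    simp

end Scalar

section Grading

variable {F} {gr : ℤ → Submodule F V}

omit [CharZero F] in
theorem tmul_mem_grT3 {p q k m : ℤ} {x y z : V} (hx : x ∈ gr p) (hy : y ∈ gr q) (hz : z ∈ gr k)
    (h : p + q + k = m) : x ⊗ₜ[F] (y ⊗ₜ[F] z) ∈ grT3 F gr m := by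
  obtain rfl : k = m - p - q := by omega
  exact Submodule.mem_iSup_of_mem (p, q) ⟨⟨x, hx⟩ ⊗ₜ (⟨y, hy⟩ ⊗ₜ ⟨z, hz⟩), by simp⟩

omit [CharZero F] in
theorem grT2_le {m : ℤ} {S : Submodule F (V ⊗[F] V)}
    (h : ∀ p q : ℤ, p + q = m → ∀ x ∈ gr p, ∀ y ∈ gr q, x ⊗ₜ[F] y ∈ S) : grT2 F gr m ≤ S := by
  refine iSup_le fun p => ?_
  rintro _ ⟨u, rfl⟩
  induction u with
  | zero => simp
  | tmul x y => exact h p (m - p) (by ring) x x.2 y y.2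
  | add a b ha hb => rw [map_add]; exact S.add_mem ha hb

omit [CharZero F] in
theorem grT3_le {m : ℤ} {S : Submodule F (V ⊗[F] (V ⊗[F] V))}
    (h : ∀ p q k : ℤ, p + q + k = m → ∀ x ∈ gr p, ∀ y ∈ gr q, ∀ z ∈ gr k,
      x ⊗ₜ[F] (y ⊗ₜ[F] z) ∈ S) : grT3 F gr m ≤ S := by
  refine iSup_le fun p => ?_
  rintro _ ⟨u, rfl⟩
  induction u with
  | zero => simp
  | add a b ha hb => rw [map_add]; exact S.add_mem ha hb
  | tmul x w =>
    induction w with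
    | zero => simp
    | add a b ha hb => rw [TensorProduct.tmul_add, map_add]; exact S.add_mem ha hb
    | tmul y z => exact h p.1 p.2 _ (by ring) x x.2 y y.2 z z.2

variable {Δ : ℤ → V →ₗ[F] V ⊗[F] V}
  (hΔ : ∀ r k : ℤ, ∀ v ∈ gr r, Δ k v ∈ grT2 F gr (r + k + 1))

omit [CharZero F] in
include hΔ in
theorem comp12_mem_grT3 {r m n : ℤ} {v : V} (hv : v ∈ gr r) :
    comp12 F Δ m n v ∈ grT3 F gr (r + m + n + 2) := by
  refine grT2_le (S := (grT3 F gr (r + m + n + 2)).comap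
    (TensorProduct.map LinearMap.id (Δ n))) (fun p q hpq x hx y hy => ?_) (hΔ r m v hv)
  refine grT2_le (S := (grT3 F gr (r + m + n + 2)).comap (TensorProduct.mk F V _ x))
    (fun p' q' hpq' y' hy' z hz => ?_) (hΔ q n y hy)
  exact tmul_mem_grT3 hx hy' hz (by omega)

omit [CharZero F] in
include hΔ in
theorem compR_mem_grT3 {r m n : ℤ} {v : V} (hv : v ∈ gr r) :
    compR F Δ Δ m n v ∈ grT3 F gr (r + m + n + 2) := by
  refine grT2_le (S := (grT3 F gr (r + m + n + 2)).comap
    ((TensorProduct.assoc F V V V).toLinearMap ∘ₗ TensorProduct.map (Δ m) LinearMap.id))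
    (fun p q hpq x hx y hy => ?_) (hΔ r n v hv)
  refine grT2_le (S := (grT3 F gr (r + m + n + 2)).comap
    ((TensorProduct.assoc F V V V).toLinearMap ∘ₗ (TensorProduct.mk F (V ⊗[F] V) V).flip y))
    (fun p' q' hpq' x' hx' z hz => ?_) (hΔ p m x hx)
  exact tmul_mem_grT3 hx' hz hy (by omega)

omit [CharZero F] in
theorem GradedDual3.comp_Tfirst {f : V ⊗[F] (V ⊗[F] V) →ₗ[F] F} (hf : GradedDual3 F gr f) :
    GradedDual3 F gr (f ∘ₗ Tfirst F) := by
  obtain ⟨s, hs⟩ := hf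
  refine ⟨s, fun m hm u hu => hs m hm _ ?_⟩
  refine grT3_le (S := (grT3 F gr m).comap (Tfirst F)) (fun p q k h x hx y hy z hz => ?_) hu
  exact tmul_mem_grT3 hy hx hz (by omega)

omit [CharZero F] in
/-- Maps shifting weights, paired with the graded dual, are supported on finitely many diagonals. -/
theorem GradedDual3.exists_bound {f : V ⊗[F] (V ⊗[F] V) →ₗ[F] F} (hf : GradedDual3 F gr f)
    (hgr : DirectSum.IsInternal gr) {T : ℤ → ℤ → V →ₗ[F] V ⊗[F] (V ⊗[F] V)}
    (hT : ∀ r m n : ℤ, ∀ v ∈ gr r, T m n v ∈ grT3 F gr (r + m + n + 2)) (v : V) :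
    ∃ B : ℕ, ∀ m n : ℤ, m + n < -B ∨ B < m + n → f (T m n v) = 0 := by
  obtain ⟨s, hs⟩ := hf
  have hv : v ∈ ⨆ r, gr r := by rw [hgr.submodule_iSup_eq_top]; trivial
  induction hv using Submodule.iSup_induction' with
  | mem r v hv =>
    refine ⟨r.natAbs + 2 + s.sup Int.natAbs, fun m n h => hs _ (fun hmem => ?_) _ (hT r m n v hv)⟩
    have := Finset.le_sup (f := Int.natAbs) hmem
    omega
  | zero => exact ⟨0, by simp⟩
  | add x y _ _ hx hy =>
    obtain ⟨B, hB⟩ := hx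
    obtain ⟨B', hB'⟩ := hy
    refine ⟨B + B', fun m n h => ?_⟩
    rw [map_add, map_add, hB m n (by omega), hB' m n (by omega), add_zero]

end Grading

/-- Left rationality and coassociativity: For a graded vertex
coalgebra `(V, Y, c)`, `v' ∈ (V^{⊗3})'` and `v ∈ V`:
(a) the series `⟨v', (Y(x₀) ⊗ Id)Y(x₂)v⟩` lies in `F[x₀⁻¹,x₂][[x₀,x₂⁻¹]]` and
equals `ι₂₀ k` for a uniquely determined rational function
`k = h/(x₀^r x₂^s (x₀+x₂)^t)`; and
(b) `ι₁₂⁻¹⟨v', (Id ⊗ Y(x₂))Y(x₁)v⟩ = (ι₂₀⁻¹⟨v', (Y(x₀) ⊗ Id)Y(x₂)v⟩)|_{x₀=x₁-x₂}`.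
Here `ι₂₀ k = C` is rendered coefficient-wise as `x₀^r x₂^s (x₀+x₂)^t · C = h`,
and (b) as `x₁^t x₂^s (x₁-x₂)^r · A = h(x₁-x₂, x₂)`. -/
theorem left_rationality_and_coassociativity
    (Δ : ℤ → V →ₗ[F] V ⊗[F] V) (c : V →ₗ[F] F) (gr : ℤ → Submodule F V)
    (hVC : IsVertexCoalg F Δ c) (hgr : IsGradedVC F Δ gr)
    (f : V ⊗[F] (V ⊗[F] V) →ₗ[F] F) (hf : GradedDual3 F gr f) (v : V)
    -- `A m n` : coefficient of `x₁^m x₂^n` in `⟨v', (Id ⊗ Y(x₂))Y(x₁)v⟩`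
    (A : ℤ → ℤ → F) (hA : A = fun m n => f (comp12 F Δ (-m - 1) (-n - 1) v))
    -- `C m n` : coefficient of `x₀^m x₂^n` in `⟨v', (Y(x₀) ⊗ Id)Y(x₂)v⟩`
    (C : ℤ → ℤ → F) (hC : C = fun m n => f (compR F Δ Δ (-m - 1) (-n - 1) v)) :
    (∃ N : ℤ, ∀ m n : ℤ, (m < -N → C m n = 0) ∧ (N < n → C m n = 0)) ∧
    ∃ (h : ℤ → ℤ → F) (r s t : ℕ), IsPolyCoeff F h ∧
      (∀ m n : ℤ, mulPoly F r s t 1 C m n = h m n) ∧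
      (∀ m n : ℤ, mulPoly F t s r (-1) A m n = substC F h m n) ∧
      (∀ (h' : ℤ → ℤ → F) (r' s' t' : ℕ), IsPolyCoeff F h' →
        (∀ m n : ℤ, mulPoly F r' s' t' 1 C m n = h' m n) →
        ∀ m n : ℤ, mulPoly F r' s' t' 1 h m n = mulPoly F r s t 1 h' m n) := by
  obtain ⟨⟨-, -, -, -, htr⟩, hJac⟩ := hVC
  obtain ⟨hint, -, hΔ⟩ := hgr
  obtain ⟨N, hN⟩ := htr v
  obtain ⟨B₁, hB₁⟩ := hf.exists_bound hint (fun _ _ _ _ => comp12_mem_grT3 hΔ) v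
  obtain ⟨B₂, hB₂⟩ := hf.comp_Tfirst.exists_bound hint (fun _ _ _ _ => comp12_mem_grT3 hΔ) v
  obtain ⟨B₃, hB₃⟩ := hf.exists_bound hint (fun _ _ _ _ => compR_mem_grT3 hΔ) v
  obtain ⟨B, hBN, h₁, h₂, h₃⟩ : ∃ B : ℕ, -(B : ℤ) ≤ N ∧ B₁ ≤ B ∧ B₂ ≤ B ∧ B₃ ≤ B :=
    ⟨N.natAbs + B₁ + B₂ + B₃, by omega, by omega, by omega, by omega⟩
  have h12 : ∀ m n : ℤ, m < N → comp12 F Δ m n v = 0 := fun m n h => by simp [comp12, hN m h]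
  have h02 : ∀ m n : ℤ, n < N → compR F Δ Δ m n v = 0 := fun m n h => by simp [compR, hN n h]
  have hP : ∀ m n : ℤ, m < -B ∨ m + n < -B ∨ B < m + n → f (comp12 F Δ m n v) = 0 := by
    rintro m n (h | h)
    · rw [h12 m n (by omega), map_zero]
    · exact hB₁ m n (by omega)
  have hQ : ∀ m n : ℤ, m < -B ∨ m + n < -B ∨ B < m + n →
      f (Tfirst F (comp12 F Δ m n v)) = 0 := by
    rintro m n (h | h)
    · rw [h12 m n (by omega), map_zero, map_zero]
    · exact hB₂ m n (by omega)
  have hR : ∀ m n : ℤ, n < -B ∨ m + n < -B ∨ B < m + n → f (compR F Δ Δ m n v) = 0 := by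
    rintro m n (h | h)
    · rw [h02 m n (by omega), map_zero]
    · exact hB₃ m n (by omega)
  have hJ : ∀ a b c : ℤ, ∑ᶠ i : ℕ, ((-1 : F) ^ i * gchoose F a i) *
        (f (comp12 F Δ (a + b - i) (c + i) v) -
          (-1 : F) ^ a * f (Tfirst F (comp12 F Δ (a + c - i) (b + i) v))) =
      ∑ᶠ i : ℕ, gchoose F b i * f (compR F Δ Δ (a + i) (b + c - i) v) := by
    intro a b c
    have hsupp (g : ℕ → V ⊗[F] (V ⊗[F] V)) (L : ℤ) (hg : ∀ i : ℕ, L < i → g i = 0) :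
        f (∑ᶠ i, g i) = ∑ᶠ i, f (g i) := by
      refine f.toAddMonoidHom.map_finsum ((Set.finite_Iic L.toNat).subset fun i hi => ?_)
      by_contra h
      exact hi (hg i (by simp at h; omega))
    have key := congrArg f (hJac a b c v)
    rw [hsupp _ (|a| + |b| + |c| + |N|), hsupp _ (|a| + |b| + |c| + |N|)] at key
    · simpa using key
    · intro i hi
      rw [h02 _ _ (by grind), smul_zero]
    · intro i hi
      rw [h12 _ _ (by grind), h12 _ _ (by grind)]
      simp
  subst hA hC
  refine ⟨⟨2 * B + 1, fun m n => ⟨fun h => ?_, fun h => hR _ _ (by omega)⟩⟩,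
    mulPoly F (2 * B + 1) (2 * B + 1) (2 * B + 1) 1
      fun m n => f (compR F Δ Δ (-m - 1) (-n - 1) v),
    2 * B + 1, 2 * B + 1, 2 * B + 1, ?_, fun _ _ => rfl, ?_, ?_⟩
  · exact hR _ _ (by omega)
  · exact isPolyCoeff_mulPoly_of_jacobi hP hQ hR hJ (by omega) (by omega) (by omega)
  · exact mulPoly_eq_substC_of_jacobi (R := fun m n => f (compR F Δ Δ m n v)) hP hQ hJ
      (t := 2 * B + 1) (by omega)
  · intro h' r' s' t' _ hh' m n
    rw [← funext₂ hh', mulPoly_comm]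
end
end

section
/- Let V be a ℤ-graded F-vector space with V_(k) = 0 for k sufficiently small, equipped with linear maps Y(x)v = Σ_{k∈ℤ}Δ_k(v)x^{-k-1} and c : V → F satisfying all the axioms of a graded vertex coalgebra except possibly the Jacobi identity. If weak coassociativity holds (for every v' ∈ (V^{⊗3})' there exists k ∈ ℤ_+ such that (x_0+x_2)^k ⟨v', (Y(x_0)⊗Id_V)Y(x_2)v − (Id_V⊗Y(x_2))Y(x_0+x_2)v⟩ = 0 for all v ∈ V) and skew-symmetry holds (T Y(x) = Y(−x)e^{xD*}, where D* = (Id_V ⊗ c)Δ_{-2}), then the Jacobi identity holds, so (V, Y, c) is a graded vertex coalgebra. -/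
/- Common background for the formalization of "Vertex coalgebras, comodules,
cocommutativity and coassociativity" (K. Hubbard).

A vertex coalgebra `(V, Y, c)` is encoded by the family of coefficient maps
`Δ k : V →ₗ V ⊗ V` of the coproduct `Y(x)v = ∑ₖ Δ k v · x^(-k-1)` together with
the covacuum `c : V →ₗ F`.  All identities of formal series are encoded
coefficient-wise; in particular the Jacobi identity is encoded by its
(dual Borcherds) coefficient form. -/

noncomputable section

open scoped TensorProduct

variable (F : Type) [Field F] [CharZero F]

variable {V M : Type} [AddCommGroup V] [Module F V] [AddCommGroup M] [Module F M]

set_option linter.unusedSectionVars false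

section BinomialSums

theorem gchoose_zero (a : ℤ) : gchoose F a 0 = 1 := by
  simp [gchoose]

theorem gchoose_succ_mul (a : ℤ) (i : ℕ) :
    gchoose F a (i + 1) * ((i : F) + 1) = gchoose F a i * ((a : F) - i) := by
  have h1 : ((i : F) + 1) ≠ 0 := by exact_mod_cast Nat.succ_ne_zero i
  have h2 : (Nat.factorial i : F) ≠ 0 := by exact_mod_cast Nat.factorial_ne_zero i
  simp only [gchoose, Finset.prod_range_succ, Nat.factorial_succ]
  push_cast
  field_simp

theorem gchoose_succ_succ (a : ℤ) (i : ℕ) :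
    gchoose F (a + 1) (i + 1) = gchoose F a (i + 1) + gchoose F a i := by
  have key : gchoose F (a + 1) (i + 1) * ((i : F) + 1) = gchoose F a i * ((a : F) + 1) := by
    have h1 : ((i : F) + 1) ≠ 0 := by exact_mod_cast Nat.succ_ne_zero i
    have h2 : (Nat.factorial i : F) ≠ 0 := by exact_mod_cast Nat.factorial_ne_zero i
    simp only [gchoose, Finset.prod_range_succ', Nat.factorial_succ]
    push_cast
    simp only [add_sub_add_right_eq_sub, sub_zero]
    field_simp
  have h1 : ((i : F) + 1) ≠ 0 := by exact_mod_cast Nat.succ_ne_zero i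
  apply mul_right_cancel₀ h1
  rw [key, add_mul, gchoose_succ_mul]
  ring

theorem gchoose_one (a : ℤ) : gchoose F a 1 = a := by
  simp [gchoose]

theorem gchoose_neg_two (i : ℕ) : gchoose F (-2) i = (-1) ^ i * ((i : F) + 1) := by
  induction i with
  | zero => simp [gchoose]
  | succ i ih =>
    have h1 : ((i : F) + 1) ≠ 0 := by exact_mod_cast Nat.succ_ne_zero i
    apply mul_right_cancel₀ h1
    rw [gchoose_succ_mul, ih]
    push_cast
    ring

/-- The sum `∑ᵢ (a choose i) uᵢ` for a finitely supported sequence `u`. -/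
def binomSum (a : ℤ) (u : ℕ → F) : F := ∑ᶠ i : ℕ, gchoose F a i * u i

variable {F}

theorem binomSum_eq_sum_range (a : ℤ) {u : ℕ → F} {M : ℕ} (hu : ∀ i, M ≤ i → u i = 0) :
    binomSum F a u = ∑ i ∈ Finset.range M, gchoose F a i * u i := by
  apply finsum_eq_sum_of_support_subset
  intro i hi
  by_contra h
  simp only [Finset.coe_range, Set.mem_Iio, not_lt] at h
  exact hi (by simp [hu i h])

theorem binomSum_zero_left {u : ℕ → F} : binomSum F 0 u = u 0 := by
  unfold binomSum
  rw [finsum_eq_single _ 0]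
  · simp [gchoose_zero]
  · intro i hi
    obtain ⟨j, rfl⟩ := Nat.exists_eq_succ_of_ne_zero hi
    simp [gchoose, Finset.prod_range_succ']

theorem binomSum_add_one (a : ℤ) {u : ℕ → F} {M : ℕ} (hu : ∀ i, M ≤ i → u i = 0) :
    binomSum F (a + 1) u = binomSum F a u + binomSum F a fun i => u (i + 1) := by
  rw [binomSum_eq_sum_range (M := M + 1) (a + 1) fun i hi => hu i (by lia),
    binomSum_eq_sum_range (M := M + 1) a fun i hi => hu i (by lia),
    binomSum_eq_sum_range (M := M) a fun i hi => hu (i + 1) (by lia),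
    Finset.sum_range_succ', Finset.sum_range_succ' _ M]
  simp only [gchoose_succ_succ, add_mul, Finset.sum_add_distrib, gchoose_zero]
  ring

/-- The left-hand side of the Jacobi identity with only its first summand,
for the coefficient function `A`. -/
def jacL (A : ℤ → ℤ → F) (a b c : ℤ) : F :=
  binomSum F a fun i => (-1) ^ i * A (a + b - i) (c + i)

/-- The right-hand side of the Jacobi identity, for the coefficient function `G`. -/
def jacR (G : ℤ → ℤ → F) (a b c : ℤ) : F :=
  binomSum F b fun i => G (a + i) (b + c - i)

/-- The difference of the two sides of the Jacobi identity for the coefficient functions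
`A`, `B`, `G` of its three terms. -/
def jacDefect (A B G : ℤ → ℤ → F) (a b c : ℤ) : F :=
  jacL A a b c - (-1) ^ a * jacL B a c b - jacR G a b c

theorem jacL_add_one {A : ℤ → ℤ → F} {N : ℤ} (hA : ∀ m n, m < N → A m n = 0) (a b c : ℤ) :
    jacL A (a + 1) b c = jacL A a (b + 1) c - jacL A a b (c + 1) := by
  unfold jacL
  rw [binomSum_add_one (M := (a + 1 + b - N + 1).toNat) a
    fun i hi => by rw [hA _ _ (by lia), mul_zero], sub_eq_add_neg]
  congr 1
  · simp only [add_right_comm a 1 b, add_assoc]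
  · unfold binomSum
    rw [← finsum_neg_distrib]
    refine finsum_congr fun i => ?_
    beta_reduce
    rw [show a + 1 + b - ((i + 1 : ℕ) : ℤ) = a + b - i by push_cast; ring,
      show c + ((i + 1 : ℕ) : ℤ) = c + 1 + i by push_cast; ring]
    ring

theorem jacR_add_one {G : ℤ → ℤ → F} {N : ℤ} (hG : ∀ m n, n < N → G m n = 0) (a b c : ℤ) :
    jacR G a (b + 1) c = jacR G a b (c + 1) + jacR G (a + 1) b c := by
  unfold jacR
  rw [binomSum_add_one (M := (b + 1 + c - N + 1).toNat) b
    fun i hi => by rw [hG _ _ (by lia)]]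
  congr 1
  · congr 1; funext i; congr 1; ring
  · congr 1; funext i; congr 1 <;> push_cast <;> ring

theorem jacDefect_add_one {A B G : ℤ → ℤ → F} {N : ℤ} (hA : ∀ m n, m < N → A m n = 0)
    (hB : ∀ m n, m < N → B m n = 0) (hG : ∀ m n, n < N → G m n = 0) (a b c : ℤ) :
    jacDefect A B G a (b + 1) c = jacDefect A B G (a + 1) b c + jacDefect A B G a b (c + 1) := by
  unfold jacDefect
  rw [jacL_add_one hA a b c, jacL_add_one hB a c b, jacR_add_one hG a b c,
    zpow_add_one₀ (by norm_num : (-1 : F) ≠ 0)]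
  ring

/-- Iterating a Pascal-type recursion in the middle variable. -/
theorem eq_sum_choose_of_add_one {J : ℤ → ℤ → ℤ → F}
    (hJ : ∀ a b c, J a (b + 1) c = J (a + 1) b c + J a b (c + 1)) (k : ℕ) (a c : ℤ) :
    J a k c = ∑ j ∈ Finset.range (k + 1), (k.choose j : F) * J (a + k - j) 0 (c + j) := by
  induction k generalizing a c with
  | zero => simp
  | succ k ih =>
    have h := Finset.sum_choose_succ_mul
      (fun j _ : ℕ => J (a + ((k + 1 : ℕ) : ℤ) - j) 0 (c + j)) k
    rw [h, Nat.cast_succ, hJ, ih, ih]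
    congr 1 <;> refine Finset.sum_congr rfl fun j _ => ?_ <;> congr 2 <;> push_cast <;> ring

/-- A solution of the Jacobi recursion vanishing for large values of the second and of the
third variable vanishes. -/
theorem eq_zero_of_add_one {J : ℤ → ℤ → ℤ → F}
    (hJ : ∀ a b c, J a (b + 1) c = J (a + 1) b c + J a b (c + 1)) {K : ℤ}
    (hb : ∀ a b c, K ≤ b → J a b c = 0) (hc : ∀ a b c, K ≤ c → J a b c = 0) (a b c : ℤ) :
    J a b c = 0 := by
  have hdown : ∀ n : ℕ, ∀ a b c, K - n ≤ b → J a b c = 0 := by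
    intro n
    induction n with
    | zero => intro a b c h; exact hb a b c (by simpa using h)
    | succ n ih =>
      intro a b c h
      have hstep : ∀ t : ℕ, ∀ a c, K - t ≤ c → J a b c = 0 := by
        intro t
        induction t with
        | zero => intro a c h; exact hc a b c (by simpa using h)
        | succ t iht =>
          intro a c hct
          have h1 := hJ (a - 1) b c
          rw [ih _ (b + 1) _ (by push_cast at h; lia), iht _ (c + 1) (by push_cast at hct; lia)] at h1
          simpa using h1.symm
      exact hstep (K - c).toNat a c (by lia)
  exact hdown (K - b).toNat a b c (by lia)

/-- The right-hand side of the Jacobi identity transforms under skew-symmetry by exchanging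
the last two variables. -/
theorem jacR_swap {G G' : ℤ → ℤ → F} {N : ℤ} (hG : ∀ m n, n < N → G m n = 0)
    (hG' : ∀ m n, n < N → G' m n = 0)
    (h : ∀ m n, G' m n = -((-1) ^ m * jacR G m n 0)) (b : ℕ) (a c : ℤ) :
    jacR G' a b c = -((-1) ^ a * jacR G a c b) := by
  induction b generalizing a c with
  | zero => rw [Nat.cast_zero, ← h]; simp [jacR, binomSum_zero_left]
  | succ b ih =>
    rw [Nat.cast_succ, jacR_add_one hG', ih, ih, jacR_add_one hG,
      zpow_add_one₀ (by norm_num : (-1 : F) ≠ 0)]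
    ring

end BinomialSums

section Pairing

variable {F}

/-- The functional `φ ⊗ χ` on a tensor product. -/
def pair (φ : V →ₗ[F] F) (χ : M →ₗ[F] F) : V ⊗[F] M →ₗ[F] F :=
  (TensorProduct.lid F F).toLinearMap ∘ₗ TensorProduct.map φ χ

theorem pair_tmul (φ : V →ₗ[F] F) (χ : M →ₗ[F] F) (x : V) (y : M) :
    pair φ χ (x ⊗ₜ y) = φ x * χ y := by
  simp [pair]

theorem pair_map {V' M' : Type} [AddCommGroup V'] [Module F V'] [AddCommGroup M'] [Module F M']
    (φ : V' →ₗ[F] F) (χ : M' →ₗ[F] F) (f : V →ₗ[F] V') (g : M →ₗ[F] M') (t : V ⊗[F] M) :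
    pair φ χ (TensorProduct.map f g t) = pair (φ ∘ₗ f) (χ ∘ₗ g) t := by
  induction t using TensorProduct.induction_on with
  | zero => simp
  | tmul x y => simp [pair_tmul]
  | add x y hx hy => simp [hx, hy]

theorem pair_comm (φ : V →ₗ[F] F) (χ : M →ₗ[F] F) (t : M ⊗[F] V) :
    pair φ χ (TensorProduct.comm F M V t) = pair χ φ t := by
  induction t using TensorProduct.induction_on with
  | zero => simp
  | tmul x y => simp [pair_tmul, mul_comm]
  | add x y hx hy => simp [hx, hy]

theorem pair_assoc {M' : Type} [AddCommGroup M'] [Module F M'] (φ : V →ₗ[F] F) (ψ : M →ₗ[F] F)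
    (χ : M' →ₗ[F] F) (t : (V ⊗[F] M) ⊗[F] M') :
    pair φ (pair ψ χ) (TensorProduct.assoc F V M M' t) = pair (pair φ ψ) χ t := by
  have : pair φ (pair ψ χ) ∘ₗ (TensorProduct.assoc F V M M').toLinearMap =
      pair (pair φ ψ) χ := by
    ext x y z
    simp [pair_tmul, mul_assoc]
  exact LinearMap.congr_fun this t

theorem pair_Tfirst (φ ψ : V →ₗ[F] F) (χ : M →ₗ[F] F) (t : V ⊗[F] (V ⊗[F] M)) :
    pair φ (pair ψ χ) (Tfirst F t) = pair ψ (pair φ χ) t := by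
  have : pair φ (pair ψ χ) ∘ₗ Tfirst F = pair ψ (pair φ χ) := by
    ext x y z
    simp [pair_tmul, Tfirst, mul_left_comm]
  exact LinearMap.congr_fun this t

theorem pair_cLeft (c : V →ₗ[F] F) (χ : M →ₗ[F] F) (t : V ⊗[F] M) :
    pair c χ t = χ (cLeft F c t) := by
  induction t using TensorProduct.induction_on with
  | zero => simp
  | tmul x y => simp [pair_tmul, cLeft]
  | add x y hx hy => simp [hx, hy]

theorem pair_cRight (φ : V →ₗ[F] F) (c : M →ₗ[F] F) (t : V ⊗[F] M) :
    pair φ c t = φ (cRight F c t) := by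
  induction t using TensorProduct.induction_on with
  | zero => simp
  | tmul x y => simp [pair_tmul, cRight, mul_comm]
  | add x y hx hy => simp [hx, hy]

theorem pair_sub_left (φ φ' : V →ₗ[F] F) (χ : M →ₗ[F] F) (t : V ⊗[F] M) :
    pair (φ - φ') χ t = pair φ χ t - pair φ' χ t := by
  induction t using TensorProduct.induction_on with
  | zero => simp
  | tmul x y => simp [pair_tmul, sub_mul]
  | add x y hx hy => simp only [map_add, hx, hy]; ring

/-- The coefficients of `⟨φ ⊗ ψ ⊗ χ, (Id ⊗ Y(x₂)) Y(x₁) w⟩`. -/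
def coeffIter (Δ : ℤ → V →ₗ[F] V ⊗[F] V) (φ ψ χ : V →ₗ[F] F) (w : V) (m n : ℤ) : F :=
  pair φ (pair ψ χ ∘ₗ Δ n) (Δ m w)

/-- The coefficients of `⟨φ ⊗ ψ ⊗ χ, (Y(x₀) ⊗ Id) Y(x₂) w⟩`. -/
def coeffNest (Δ : ℤ → V →ₗ[F] V ⊗[F] V) (φ ψ χ : V →ₗ[F] F) (w : V) (m n : ℤ) : F :=
  pair (pair φ ψ ∘ₗ Δ m) χ (Δ n w)

variable (Δ : ℤ → V →ₗ[F] V ⊗[F] V)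

theorem pair_comp12 (φ ψ χ : V →ₗ[F] F) (w : V) (m n : ℤ) :
    pair φ (pair ψ χ) (comp12 F Δ m n w) = coeffIter Δ φ ψ χ w m n := by
  simp [comp12, pair_map, coeffIter]

theorem pair_compR (φ ψ χ : V →ₗ[F] F) (w : V) (m n : ℤ) :
    pair φ (pair ψ χ) (compR F Δ Δ m n w) = coeffNest Δ φ ψ χ w m n := by
  simp [compR, pair_map, pair_assoc, coeffNest]

variable {Δ} {w : V} {N : ℤ}

theorem coeffIter_eq_zero (hN : ∀ k, k < N → Δ k w = 0) (φ ψ χ : V →ₗ[F] F) (m n : ℤ)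
    (h : m < N) : coeffIter Δ φ ψ χ w m n = 0 := by
  simp [coeffIter, hN m h]

theorem coeffNest_eq_zero (hN : ∀ k, k < N → Δ k w = 0) (φ ψ χ : V →ₗ[F] F) (m n : ℤ)
    (h : n < N) : coeffNest Δ φ ψ χ w m n = 0 := by
  simp [coeffNest, hN n h]

/-- Pairing the left-hand side of the Jacobi identity with `φ ⊗ ψ ⊗ χ`. -/
theorem pair_jacobi_left (hN : ∀ k, k < N → Δ k w = 0) (φ ψ χ : V →ₗ[F] F) (a b c : ℤ) :
    pair φ (pair ψ χ) (∑ᶠ i : ℕ, ((-1 : F) ^ i * gchoose F a i) •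
        (comp12 F Δ (a + b - i) (c + i) w -
          (-1 : F) ^ a • Tfirst F (comp12 F Δ (a + c - i) (b + i) w))) =
      jacL (coeffIter Δ φ ψ χ w) a b c - (-1) ^ a * jacL (coeffIter Δ ψ φ χ w) a c b := by
  have hz : ∀ m n, m < N → comp12 F Δ m n w = 0 := fun m n h => by simp [comp12, hN m h]
  set L := (a + b - N).toNat + (a + c - N).toNat + 1
  rw [finsum_eq_sum_of_support_subset (s := Finset.range L)]
  · unfold jacL
    rw [binomSum_eq_sum_range (M := L) a
        fun i hi => by rw [coeffIter_eq_zero hN _ _ _ _ _ (by lia), mul_zero],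
      binomSum_eq_sum_range (M := L) a
        fun i hi => by rw [coeffIter_eq_zero hN _ _ _ _ _ (by lia), mul_zero],
      map_sum, Finset.mul_sum, ← Finset.sum_sub_distrib]
    refine Finset.sum_congr rfl fun i _ => ?_
    simp only [map_smul, map_sub, pair_Tfirst, pair_comp12, smul_eq_mul]
    ring
  · intro i hi
    by_contra h
    simp only [Finset.coe_range, Set.mem_Iio, not_lt] at h
    exact hi (by simp [hz (a + b - i) (c + i) (by lia), hz (a + c - i) (b + i) (by lia)])

/-- Pairing the right-hand side of the Jacobi identity with `φ ⊗ ψ ⊗ χ`. -/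
theorem pair_jacobi_right (hN : ∀ k, k < N → Δ k w = 0) (φ ψ χ : V →ₗ[F] F) (a b c : ℤ) :
    pair φ (pair ψ χ) (∑ᶠ i : ℕ, gchoose F b i • compR F Δ Δ (a + i) (b + c - i) w) =
      jacR (coeffNest Δ φ ψ χ w) a b c := by
  have hz : ∀ m n, n < N → compR F Δ Δ m n w = 0 := fun m n h => by simp [compR, hN n h]
  set L := (b + c - N).toNat + 1
  rw [finsum_eq_sum_of_support_subset (s := Finset.range L)]
  · unfold jacR
    rw [binomSum_eq_sum_range (M := L) b
        fun i hi => coeffNest_eq_zero hN _ _ _ _ _ (by lia), map_sum]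
    refine Finset.sum_congr rfl fun i _ => ?_
    simp only [map_smul, pair_compR, smul_eq_mul]
  · intro i hi
    by_contra h
    simp only [Finset.coe_range, Set.mem_Iio, not_lt] at h
    exact hi (by simp [hz (a + i) (b + c - i) (by lia)])

/-- Weak coassociativity with exponent `k` is the Jacobi identity, without its second term,
for `b` at least `k`. -/
theorem WeakCoassoc.jacL_eq_jacR {φ ψ χ : V →ₗ[F] F} {k : ℕ}
    (h : WeakCoassoc F Δ Δ (pair φ (pair ψ χ)) k) (hN : ∀ k, k < N → Δ k w = 0)
    (a b c : ℤ) (hb : k ≤ b) :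
    jacL (coeffIter Δ φ ψ χ w) a b c = jacR (coeffNest Δ φ ψ χ w) a b c := by
  set J := jacDefect (coeffIter Δ φ ψ χ w) 0 (coeffNest Δ φ ψ χ w) with hJ
  have hJ' : ∀ a b c, J a b c =
      jacL (coeffIter Δ φ ψ χ w) a b c - jacR (coeffNest Δ φ ψ χ w) a b c := by
    intro a b c
    simp [hJ, jacDefect, jacL, binomSum]
  have hrec : ∀ a b c, J a (b + 1) c = J (a + 1) b c + J a b (c + 1) :=
    jacDefect_add_one (coeffIter_eq_zero hN φ ψ χ) (fun _ _ _ => rfl)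
      (coeffNest_eq_zero hN φ ψ χ)
  have hk : ∀ a c, J a k c = 0 := by
    intro a c
    rw [eq_sum_choose_of_add_one hrec, ← neg_eq_zero, ← Finset.sum_neg_distrib, ← h w a c]
    refine Finset.sum_congr rfl fun j _ => ?_
    rw [hJ', ← mul_neg, neg_sub]
    congr 2
    · simp [jacR, binomSum_zero_left, pair_compR]
    · unfold jacL binomSum
      refine finsum_congr fun i => ?_
      rw [pair_comp12, add_zero]
      ring
  have hall : ∀ t : ℕ, ∀ a c, J a (k + t) c = 0 := by
    intro t
    induction t with
    | zero => simpa using hk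
    | succ t ih =>
      intro a c
      rw [Nat.cast_succ, ← add_assoc, hrec, ih, ih, add_zero]
  obtain ⟨t, rfl⟩ := Int.le.dest hb
  exact sub_eq_zero.1 ((hJ' _ _ _).symm.trans (hall t a c))

end Pairing

section Homogeneous

variable {F}

/-- A functional on a graded space is homogeneous of weight `p` if it vanishes on every
component of weight other than `p`. -/
def IsHomDual (gr : ℤ → Submodule F V) (p : ℤ) (φ : V →ₗ[F] F) : Prop :=
  ∀ m, m ≠ p → ∀ x ∈ gr m, φ x = 0

variable {gr : ℤ → Submodule F V}

/-- A functional that vanishes on all `x ⊗ y` with `x`, `y` homogeneous of total weight `m`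
vanishes on the weight-`m` component of `V ⊗ V`. -/
theorem eq_zero_of_mem_grT2 {f : V ⊗[F] V →ₗ[F] F} {m : ℤ}
    (hf : ∀ q, ∀ x ∈ gr q, ∀ y ∈ gr (m - q), f (x ⊗ₜ y) = 0) {t : V ⊗[F] V}
    (ht : t ∈ grT2 F gr m) : f t = 0 := by
  suffices h : grT2 F gr m ≤ LinearMap.ker f from h ht
  refine iSup_le fun q => ?_
  rintro _ ⟨u, rfl⟩
  rw [LinearMap.mem_ker]
  induction u using TensorProduct.induction_on with
  | zero => simp
  | tmul x y => simpa using hf q x x.2 y y.2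
  | add x y hx hy => simp [hx, hy]

theorem IsHomDual.pair_eq_zero {φ χ : V →ₗ[F] F} {p q m : ℤ} (hφ : IsHomDual gr p φ)
    (hχ : IsHomDual gr q χ) (hm : m ≠ p + q) {t : V ⊗[F] V} (ht : t ∈ grT2 F gr m) :
    pair φ χ t = 0 := by
  refine eq_zero_of_mem_grT2 (fun s x hx y hy => ?_) ht
  rw [pair_tmul]
  by_cases hs : s = p
  · rw [hχ (m - s) (by lia) y hy, mul_zero]
  · rw [hφ s hs x hx, zero_mul]

theorem IsHomDual.pair_comp {Δ : ℤ → V →ₗ[F] V ⊗[F] V}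
    (hΔ : ∀ r k : ℤ, ∀ v ∈ gr r, Δ k v ∈ grT2 F gr (r + k + 1)) {φ χ : V →ₗ[F] F} {p q : ℤ}
    (hφ : IsHomDual gr p φ) (hχ : IsHomDual gr q χ) (n : ℤ) :
    IsHomDual gr (p + q - n - 1) (pair φ χ ∘ₗ Δ n) := fun m hm x hx =>
  hφ.pair_eq_zero hχ (by lia) (hΔ m n x hx)

theorem IsHomDual.gradedDual3 {φ ψ χ : V →ₗ[F] F} {p q s : ℤ} (hφ : IsHomDual gr p φ)
    (hψ : IsHomDual gr q ψ) (hχ : IsHomDual gr s χ) : GradedDual3 F gr (pair φ (pair ψ χ)) := by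
  refine ⟨{p + q + s}, fun m hm u hu => ?_⟩
  rw [Finset.mem_singleton] at hm
  suffices h : grT3 F gr m ≤ LinearMap.ker (pair φ (pair ψ χ)) from h hu
  refine iSup_le fun r => ?_
  rintro _ ⟨u, rfl⟩
  have hzero : pair φ (pair ψ χ) ∘ₗ TensorProduct.map (gr r.1).subtype
      (TensorProduct.map (gr r.2).subtype (gr (m - r.1 - r.2)).subtype) = 0 := by
    ext x y z
    suffices h : φ x = 0 ∨ ψ y = 0 ∨ χ z = 0 by simpa [pair_tmul] using h
    by_cases h1 : r.1 = p
    · by_cases h2 : r.2 = q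
      · exact Or.inr (Or.inr (hχ _ (by lia) z z.2))
      · exact Or.inr (Or.inl (hψ _ h2 y y.2))
    · exact Or.inl (hφ _ h1 x x.2)
  exact LinearMap.congr_fun hzero u

theorem eq_of_forall_mem_gr (hgr : DirectSum.IsInternal gr) {f g : V →ₗ[F] F}
    (h : ∀ m, ∀ x ∈ gr m, f x = g x) : f = g := by
  have htop : (⨆ m, gr m) ≤ LinearMap.eqLocus f g := iSup_le fun m x hx => h m x hx
  rw [hgr.submodule_iSup_eq_top] at htop
  ext x
  exact htop Submodule.mem_top

theorem exists_homogeneous_basis (hgr : DirectSum.IsInternal gr) :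
    ∃ (ι : Type) (b : Module.Basis ι F V), ∀ i, ∃ p, IsHomDual gr p (b.coord i) := by
  classical
  refine ⟨_, hgr.collectedBasis fun m => Module.Basis.ofVectorSpace F (gr m), fun i => ⟨i.1, ?_⟩⟩
  intro m hm x hx
  exact hgr.collectedBasis_repr_of_mem_ne _ hm hx

theorem eq_of_forall_isHomDual (hgr : DirectSum.IsInternal gr) {x y : V}
    (h : ∀ p φ, IsHomDual gr p φ → φ x = φ y) : x = y := by
  obtain ⟨ι, b, hb⟩ := exists_homogeneous_basis hgr
  refine b.ext_elem fun i => ?_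
  obtain ⟨p, hp⟩ := hb i
  exact h p _ hp

theorem eq_of_forall_pair (hgr : DirectSum.IsInternal gr) {x y : V ⊗[F] V}
    (h : ∀ p φ q χ, IsHomDual gr p φ → IsHomDual gr q χ → pair φ χ x = pair φ χ y) : x = y := by
  obtain ⟨ι, b, hb⟩ := exists_homogeneous_basis hgr
  refine (b.tensorProduct b).ext_elem fun ⟨i, j⟩ => ?_
  obtain ⟨p, hp⟩ := hb i
  obtain ⟨q, hq⟩ := hb j
  have hc : (b.tensorProduct b).coord (i, j) = pair (b.coord i) (b.coord j) := by
    ext u v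
    simp [pair_tmul, mul_comm]
  have := h p _ q _ hp hq
  rwa [← hc] at this

theorem eq_of_forall_pair_pair (hgr : DirectSum.IsInternal gr) {x y : V ⊗[F] (V ⊗[F] V)}
    (h : ∀ p φ q ψ s χ, IsHomDual gr p φ → IsHomDual gr q ψ → IsHomDual gr s χ →
      pair φ (pair ψ χ) x = pair φ (pair ψ χ) y) : x = y := by
  obtain ⟨ι, b, hb⟩ := exists_homogeneous_basis hgr
  refine (b.tensorProduct (b.tensorProduct b)).ext_elem fun ⟨i, j, k⟩ => ?_
  obtain ⟨p, hp⟩ := hb i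
  obtain ⟨q, hq⟩ := hb j
  obtain ⟨s, hs⟩ := hb k
  have hc : (b.tensorProduct (b.tensorProduct b)).coord (i, j, k) =
      pair (b.coord i) (pair (b.coord j) (b.coord k)) := by
    ext u v z
    simp [pair_tmul, mul_comm]
  have := h p _ q _ s _ hp hq hs
  rwa [← hc] at this

/-- A homogeneous functional whose weight lies below the grading vanishes. -/
theorem IsHomDual.eq_zero (hgr : DirectSum.IsInternal gr) {N : ℤ} (hN : ∀ k, k < N → gr k = ⊥)
    {φ : V →ₗ[F] F} {p : ℤ} (hφ : IsHomDual gr p φ) (hp : p < N) : φ = 0 := by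
  refine eq_of_forall_mem_gr hgr fun m x hx => ?_
  by_cases hm : m = p
  · rw [hm, hN p hp, Submodule.mem_bot] at hx
    simp [hx]
  · exact hφ m hm x hx

/-- The weight-zero part of a functional. -/
theorem exists_weight_zero_part (hgr : DirectSum.IsInternal gr) (c : V →ₗ[F] F) :
    ∃ c₀ : V →ₗ[F] F, IsHomDual gr 0 c₀ ∧ ∀ x ∈ gr 0, c₀ x = c x := by
  classical
  let e := LinearEquiv.ofBijective (DirectSum.coeLinearMap gr) hgr
  have he : ∀ m (x : gr m), e.symm x = DirectSum.lof F ℤ (fun i => gr i) m x := by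
    intro m x
    rw [LinearEquiv.symm_apply_eq]
    exact (DirectSum.coeLinearMap_lof gr m x).symm
  refine ⟨c ∘ₗ (gr 0).subtype ∘ₗ DirectSum.component F ℤ (fun i => gr i) 0 ∘ₗ
    e.symm.toLinearMap, fun m hm x hx => ?_, fun x hx => ?_⟩
  · have := he m ⟨x, hx⟩
    simp only [LinearMap.comp_apply, LinearEquiv.coe_coe]
    simp only at this
    rw [this, DirectSum.component.of, dif_neg hm]
    simp
  · have := he 0 ⟨x, hx⟩
    simp only [LinearMap.comp_apply, LinearEquiv.coe_coe]
    simp only at this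
    rw [this, DirectSum.component.lof_self]
    simp

end Homogeneous

section SkewSymmetry

variable {F} {gr : ℤ → Submodule F V} {Δ : ℤ → V →ₗ[F] V ⊗[F] V} {c c₀ : V →ₗ[F] F}

/-- In the presence of the left counit axiom, the counit may be replaced by its weight-zero
part on the left. -/
theorem pair_weight_zero_part (hsans : IsVertexCoalgSansJacobi F Δ c) (hgr : IsGradedVC F Δ gr)
    (hc₀ : IsHomDual gr 0 c₀) (hc : ∀ x ∈ gr 0, c₀ x = c x) {s : ℤ} {χ : V →ₗ[F] F}
    (hχ : IsHomDual gr s χ) (n : ℤ) (w : V) :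
    pair c₀ χ (Δ n w) = pair c χ (Δ n w) := by
  suffices h : pair c₀ χ ∘ₗ Δ n = pair c χ ∘ₗ Δ n from LinearMap.congr_fun h w
  refine eq_of_forall_mem_gr hgr.1 fun r x hx => ?_
  have hmem := hgr.2.2 r n x hx
  simp only [LinearMap.comp_apply]
  by_cases hs : s = r + n + 1
  · rw [← sub_eq_zero, ← pair_sub_left]
    refine eq_zero_of_mem_grT2 (fun q y hy z hz => ?_) hmem
    rw [pair_tmul]
    by_cases hq : q = 0
    · subst hq
      rw [LinearMap.sub_apply, hc y hy, sub_self, zero_mul]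
    · rw [hχ _ (by lia) z hz, mul_zero]
  · rw [hc₀.pair_eq_zero hχ (by lia) hmem, pair_cLeft]
    by_cases hn : n = -1
    · subst hn
      rw [hsans.1, hχ r (by lia) x hx]
    · rw [hsans.2.1 n hn, map_zero]

variable (F Δ c) in
/-- Skew-symmetry `T Y(x) = Y(-x) e^{x D*}` in coefficient form. -/
def SkewSymmetry : Prop :=
  ∀ (k : ℤ) (v : V),
    (Function.support fun j : ℕ =>
        ((-1 : F) ^ (k + j + 1) * (Nat.factorial j : F)⁻¹) •
          Δ (k + j) (((cRight F c ∘ₗ Δ (-2)) ^ j) v)).Finite ∧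
    (TensorProduct.comm F V V) (Δ k v) =
      ∑ᶠ j : ℕ, ((-1 : F) ^ (k + j + 1) * (Nat.factorial j : F)⁻¹) •
        Δ (k + j) (((cRight F c ∘ₗ Δ (-2)) ^ j) v)

theorem cLeft_weight_zero_part (hsans : IsVertexCoalgSansJacobi F Δ c)
    (hgr : IsGradedVC F Δ gr) (hc₀ : IsHomDual gr 0 c₀) (hc : ∀ x ∈ gr 0, c₀ x = c x)
    (n : ℤ) (w : V) : cLeft F c₀ (Δ n w) = cLeft F c (Δ n w) := by
  refine eq_of_forall_isHomDual hgr.1 fun s χ hχ => ?_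
  rw [← pair_cLeft, ← pair_cLeft, pair_weight_zero_part hsans hgr hc₀ hc hχ]

theorem cRight_weight_zero_part (hsans : IsVertexCoalgSansJacobi F Δ c)
    (hgr : IsGradedVC F Δ gr) (hskew : SkewSymmetry F Δ c) (hc₀ : IsHomDual gr 0 c₀)
    (hc : ∀ x ∈ gr 0, c₀ x = c x) (n : ℤ) (w : V) :
    cRight F c₀ (Δ n w) = cRight F c (Δ n w) := by
  refine eq_of_forall_isHomDual hgr.1 fun s χ hχ => ?_
  rw [← pair_cRight, ← pair_cRight, ← pair_comm c₀, ← pair_comm c, (hskew n w).2,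
    map_finsum (pair c₀ χ) (hskew n w).1, map_finsum (pair c χ) (hskew n w).1]
  refine finsum_congr fun j => ?_
  rw [map_smul, map_smul, pair_weight_zero_part hsans hgr hc₀ hc hχ]

/-- The coderivation property `(D* ⊗ Id) Y(x) = (d/dx) Y(x)`. -/
theorem map_coderivation (hsans : IsVertexCoalgSansJacobi F Δ c) (hgr : IsGradedVC F Δ gr)
    (hwassoc : ∀ f : V ⊗[F] (V ⊗[F] V) →ₗ[F] F, GradedDual3 F gr f →
      ∃ k : ℕ, 0 < k ∧ WeakCoassoc F Δ Δ f k)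
    (hc : IsHomDual gr 0 c) (n : ℤ) (w : V) :
    TensorProduct.map (cRight F c ∘ₗ Δ (-2)) LinearMap.id (Δ n w) = (-n : F) • Δ (n - 1) w := by
  obtain ⟨hL, hL', hR, hR', htr⟩ := hsans
  obtain ⟨N, hN⟩ := htr w
  refine eq_of_forall_pair hgr.1 fun p φ q χ hφ hχ => ?_
  obtain ⟨K, -, hK⟩ := hwassoc _ (hφ.gradedDual3 hc hχ)
  set k : ℕ := K + (n + 1).toNat
  have key := hK.jacL_eq_jacR hN (-2) k (n - k) (by lia)
  have hA : ∀ m, coeffIter Δ φ c χ w m (-1) = pair φ χ (Δ m w) := by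
    intro m
    have : pair c χ ∘ₗ Δ (-1) = χ := by
      ext x
      simp [pair_cLeft, hL]
    rw [coeffIter, this]
  have hA' : ∀ m n, n ≠ -1 → coeffIter Δ φ c χ w m n = 0 := by
    intro m n hn
    have : pair c χ ∘ₗ Δ n = 0 := by
      ext x
      simp [pair_cLeft, hL' n hn]
    rw [coeffIter, this]
    simp [pair]
  have hG0 : ∀ m n, 0 ≤ m → coeffNest Δ φ c χ w m n = 0 := by
    intro m n hm
    have : pair φ c ∘ₗ Δ m = 0 := by
      ext x
      simp [pair_cRight, hR' m hm]
    rw [coeffNest, this]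
    simp [pair]
  have hG1 : ∀ n, coeffNest Δ φ c χ w (-1) n = pair φ χ (Δ n w) := by
    intro n
    have : pair φ c ∘ₗ Δ (-1) = φ := by
      ext x
      simp [pair_cRight, hR]
    rw [coeffNest, this]
  have hG2 : ∀ n, coeffNest Δ φ c χ w (-2) n =
      pair φ χ (TensorProduct.map (cRight F c ∘ₗ Δ (-2)) LinearMap.id (Δ n w)) := by
    intro n
    have : pair φ c ∘ₗ Δ (-2) = φ ∘ₗ cRight F c ∘ₗ Δ (-2) := by
      ext x
      simp [pair_cRight]
    rw [coeffNest, this, pair_map, LinearMap.comp_id]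
  have hleft : jacL (coeffIter Δ φ c χ w) (-2) k (n - k) =
      ((k : F) - n) * pair φ χ (Δ (n - 1) w) := by
    obtain ⟨i, hi⟩ : ∃ i : ℕ, (i : ℤ) = k - n - 1 := ⟨(k - n - 1 : ℤ).toNat, by lia⟩
    have hi' : (i : F) + 1 = k - n := by
      have := congrArg (Int.cast : ℤ → F) hi
      push_cast at this
      rw [this]; ring
    unfold jacL binomSum
    rw [finsum_eq_single _ i]
    · beta_reduce
      rw [show (-2 + k - i : ℤ) = n - 1 by lia, show n - k + (i : ℤ) = -1 by lia, hA,
        gchoose_neg_two, hi']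
      have hs : (-1 : F) ^ i * (-1) ^ i = 1 := by rw [← mul_pow]; simp
      linear_combination ((k : F) - n) * pair φ χ (Δ (n - 1) w) * hs
    · intro j hj
      beta_reduce
      rw [hA' _ _ (by lia), mul_zero, mul_zero]
  have hright : jacR (coeffNest Δ φ c χ w) (-2) k (n - k) =
      coeffNest Δ φ c χ w (-2) n + k * pair φ χ (Δ (n - 1) w) := by
    unfold jacR
    rw [binomSum_eq_sum_range (M := 2) _ fun i hi => hG0 _ _ (by lia), Finset.sum_range_succ,
      Finset.sum_range_one, gchoose_zero, gchoose_one, ← hG1]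
    simp
  rw [← hG2, map_smul, smul_eq_mul]
  linear_combination hleft - hright - key

theorem map_coderivation_pow (D : V →ₗ[F] V)
    (hD : ∀ n w, TensorProduct.map D LinearMap.id (Δ n w) = (-n : F) • Δ (n - 1) w)
    (j : ℕ) (n : ℤ) (w : V) :
    TensorProduct.map (D ^ j) LinearMap.id (Δ n w) =
      ((-1) ^ j * (Nat.factorial j : F) * gchoose F n j) • Δ (n - j) w := by
  induction j with
  | zero => simp [gchoose_zero, Module.End.one_eq_id]
  | succ j ih =>
    have : TensorProduct.map (D ^ (j + 1)) (LinearMap.id : V →ₗ[F] V) =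
        TensorProduct.map D LinearMap.id ∘ₗ TensorProduct.map (D ^ j) LinearMap.id := by
      rw [← TensorProduct.map_comp, pow_succ', LinearMap.id_comp, Module.End.mul_eq_comp]
    rw [this, LinearMap.comp_apply, ih, map_smul, hD, smul_smul, Nat.factorial_succ]
    congr 1
    · have := gchoose_succ_mul F n j
      push_cast
      linear_combination (-1) ^ j * (Nat.factorial j : F) * this
    · congr 1
      push_cast
      ring_nf

/-- Skew-symmetry in the first tensor factor, paired with a decomposable functional. -/
theorem SkewSymmetry.pair_eq_sum (hskew : SkewSymmetry F Δ c) (φ ψ χ : V →ₗ[F] F) (m : ℤ)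
    (t : V ⊗[F] V) :
    ∃ M : ℕ, ∀ M', M ≤ M' → pair (pair ψ φ ∘ₗ Δ m) χ t =
      ∑ j ∈ Finset.range M', ((-1 : F) ^ (m + j + 1) * (Nat.factorial j : F)⁻¹) *
        pair (pair φ ψ ∘ₗ Δ (m + j)) χ
          (TensorProduct.map ((cRight F c ∘ₗ Δ (-2)) ^ j) LinearMap.id t) := by
  induction t using TensorProduct.induction_on with
  | zero => exact ⟨0, by simp⟩
  | tmul x y =>
    obtain ⟨hfin, hx⟩ := hskew m x
    obtain ⟨M, hM⟩ := hfin.bddAbove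
    refine ⟨M + 1, fun M' hM' => ?_⟩
    rw [pair_tmul, LinearMap.comp_apply, ← pair_comm, hx,
      finsum_eq_sum_of_support_subset (s := Finset.range M'), map_sum, Finset.sum_mul]
    · refine Finset.sum_congr rfl fun j _ => ?_
      rw [map_smul, TensorProduct.map_tmul, pair_tmul, smul_eq_mul, mul_assoc]
      rfl
    · intro j hj
      have := hM hj
      simp only [Finset.coe_range, Set.mem_Iio]
      lia
  | add x y hx hy =>
    obtain ⟨M₁, h₁⟩ := hx
    obtain ⟨M₂, h₂⟩ := hy
    refine ⟨max M₁ M₂, fun M' hM' => ?_⟩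
    simp only [map_add, h₁ M' (le_of_max_le_left hM'), h₂ M' (le_of_max_le_right hM'), mul_add,
      Finset.sum_add_distrib]

/-- Skew-symmetry in terms of the coefficients of `(Y(x₀) ⊗ Id) Y(x₂)`. -/
theorem SkewSymmetry.coeffNest_swap (hskew : SkewSymmetry F Δ c)
    (hD : ∀ n w, TensorProduct.map (cRight F c ∘ₗ Δ (-2)) LinearMap.id (Δ n w) =
      (-n : F) • Δ (n - 1) w)
    {w : V} {N : ℤ} (hN : ∀ k, k < N → Δ k w = 0) (φ ψ χ : V →ₗ[F] F) (m n : ℤ) :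
    coeffNest Δ ψ φ χ w m n = -((-1) ^ m * jacR (coeffNest Δ φ ψ χ w) m n 0) := by
  obtain ⟨M, hM⟩ := hskew.pair_eq_sum φ ψ χ m (Δ n w)
  unfold jacR
  rw [binomSum_eq_sum_range (M := M + (n - N + 1).toNat) n
      fun i hi => coeffNest_eq_zero hN _ _ _ _ _ (by lia),
    coeffNest, hM (M + (n - N + 1).toNat) (by lia), Finset.mul_sum, ← Finset.sum_neg_distrib]
  refine Finset.sum_congr rfl fun j _ => ?_
  have hj : (Nat.factorial j : F)⁻¹ * (Nat.factorial j : F) = 1 :=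
    inv_mul_cancel₀ (by exact_mod_cast Nat.factorial_ne_zero j)
  have hs : (-1 : F) ^ j * (-1) ^ j = 1 := by rw [← mul_pow]; simp
  rw [map_coderivation_pow _ hD, map_smul, smul_eq_mul, coeffNest, add_zero,
    zpow_add_one₀ (by norm_num), zpow_add₀ (by norm_num), zpow_natCast]
  linear_combination (-(-1) ^ m * gchoose F n j *
    (pair (pair φ ψ ∘ₗ Δ (m + j)) χ) (Δ (n - j) w)) *
      ((Nat.factorial j : F)⁻¹ * (Nat.factorial j : F) * hs + hj)

/-- The coefficients of `⟨φ ⊗ ψ ⊗ χ, (Id ⊗ Y(x₂)) Y(x₁) w⟩` vanish for large second index. -/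
theorem exists_coeffIter_eq_zero (hgr : IsGradedVC F Δ gr) {w : V} {N : ℤ}
    (hN : ∀ k, k < N → Δ k w = 0) {φ ψ χ : V →ₗ[F] F} {p q s : ℤ} (hφ : IsHomDual gr p φ)
    (hψ : IsHomDual gr q ψ) (hχ : IsHomDual gr s χ) :
    ∃ K : ℤ, ∀ m n, K ≤ n → coeffIter Δ φ ψ χ w m n = 0 := by
  obtain ⟨N₀, hN₀⟩ := hgr.2.1
  refine ⟨p + q + s - N - N₀, fun m n hn => ?_⟩
  by_cases hm : m < N
  · exact coeffIter_eq_zero hN _ _ _ _ _ hm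
  · have hz := (hφ.pair_comp hgr.2.2 (hψ.pair_comp hgr.2.2 hχ n) m).eq_zero hgr.1 hN₀ (by lia)
    exact LinearMap.congr_fun hz w

/-- The paired Jacobi identity holds when the second index is large. -/
theorem exists_jacDefect_eq_zero (hgr : IsGradedVC F Δ gr)
    (hwassoc : ∀ f : V ⊗[F] (V ⊗[F] V) →ₗ[F] F, GradedDual3 F gr f →
      ∃ k : ℕ, 0 < k ∧ WeakCoassoc F Δ Δ f k)
    {w : V} {N : ℤ} (hN : ∀ k, k < N → Δ k w = 0) {φ ψ χ : V →ₗ[F] F} {p q s : ℤ}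
    (hφ : IsHomDual gr p φ) (hψ : IsHomDual gr q ψ) (hχ : IsHomDual gr s χ) :
    ∃ K : ℤ, ∀ a b c, K ≤ b → jacDefect (coeffIter Δ φ ψ χ w) (coeffIter Δ ψ φ χ w)
      (coeffNest Δ φ ψ χ w) a b c = 0 := by
  obtain ⟨k, -, hk⟩ := hwassoc _ (hφ.gradedDual3 hψ hχ)
  obtain ⟨K, hK⟩ := exists_coeffIter_eq_zero hgr hN hψ hφ hχ
  refine ⟨max k K, fun a b c hb => ?_⟩
  have hB : jacL (coeffIter Δ ψ φ χ w) a c b = 0 := by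
    unfold jacL
    rw [binomSum_eq_sum_range (M := 0) a fun i _ => by rw [hK _ _ (by lia), mul_zero]]
    simp
  rw [jacDefect, hk.jacL_eq_jacR hN a b c (by lia), hB]
  ring

/-- The paired Jacobi identity transforms under skew-symmetry by exchanging the last two
variables. -/
theorem SkewSymmetry.jacDefect_swap (hskew : SkewSymmetry F Δ c)
    (hD : ∀ n w, TensorProduct.map (cRight F c ∘ₗ Δ (-2)) LinearMap.id (Δ n w) =
      (-n : F) • Δ (n - 1) w)
    {w : V} {N : ℤ} (hN : ∀ k, k < N → Δ k w = 0) (φ ψ χ : V →ₗ[F] F) (a d : ℤ) (b : ℕ) :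
    jacDefect (coeffIter Δ ψ φ χ w) (coeffIter Δ φ ψ χ w) (coeffNest Δ ψ φ χ w) a b d =
      -((-1) ^ a * jacDefect (coeffIter Δ φ ψ χ w) (coeffIter Δ ψ φ χ w)
        (coeffNest Δ φ ψ χ w) a d b) := by
  have hs : (-1 : F) ^ a * (-1) ^ a = 1 := by rw [← mul_zpow]; simp
  unfold jacDefect
  rw [jacR_swap (coeffNest_eq_zero hN φ ψ χ) (coeffNest_eq_zero hN ψ φ χ)
    (hskew.coeffNest_swap hD hN φ ψ χ)]
  linear_combination (-jacL (coeffIter Δ ψ φ χ w) a b d) * hs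

/-- The Jacobi identity for a homogeneous counit. -/
theorem SkewSymmetry.jacobiId (hskew : SkewSymmetry F Δ c)
    (hsans : IsVertexCoalgSansJacobi F Δ c) (hgr : IsGradedVC F Δ gr)
    (hwassoc : ∀ f : V ⊗[F] (V ⊗[F] V) →ₗ[F] F, GradedDual3 F gr f →
      ∃ k : ℕ, 0 < k ∧ WeakCoassoc F Δ Δ f k)
    (hc : IsHomDual gr 0 c) : JacobiId F Δ Δ := by
  intro a b d w
  have hD := map_coderivation hsans hgr hwassoc hc
  obtain ⟨N, hN⟩ := hsans.2.2.2.2 w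
  refine eq_of_forall_pair_pair hgr.1 fun p φ q ψ s χ hφ hψ hχ => ?_
  rw [pair_jacobi_left hN, pair_jacobi_right hN, ← sub_eq_zero]
  obtain ⟨K₁, hK₁⟩ := exists_jacDefect_eq_zero hgr hwassoc hN hφ hψ hχ
  obtain ⟨K₂, hK₂⟩ := exists_jacDefect_eq_zero hgr hwassoc hN hψ hφ hχ
  refine eq_zero_of_add_one (K := max 0 (max K₁ K₂))
    (jacDefect_add_one (coeffIter_eq_zero hN φ ψ χ) (coeffIter_eq_zero hN ψ φ χ)
      (coeffNest_eq_zero hN φ ψ χ)) (fun a b d hb => hK₁ a b d (by lia)) (fun a b d hd => ?_) a b d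
  lift d to ℕ using by lia
  have h := hskew.jacDefect_swap hD hN φ ψ χ a b d
  rw [hK₂ a d b (by lia), eq_comm, neg_eq_zero] at h
  exact (mul_eq_zero.1 h).resolve_left (zpow_ne_zero _ (by norm_num))

end SkewSymmetry

/-- If `(V, Y, c)` satisfies all the axioms of a graded vertex
coalgebra except possibly the Jacobi identity, and weak coassociativity and
skew-symmetry `T Y(x) = Y(-x) e^{x D*}` hold, then the Jacobi identity holds,
so `(V, Y, c)` is a graded vertex coalgebra. -/
theorem jacobi_from_weak_coassoc_and_skew_symmetry
    (Δ : ℤ → V →ₗ[F] V ⊗[F] V) (c : V →ₗ[F] F) (gr : ℤ → Submodule F V)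
    (hsans : IsVertexCoalgSansJacobi F Δ c) (hgr : IsGradedVC F Δ gr)
    (hwassoc : ∀ (f : V ⊗[F] (V ⊗[F] V) →ₗ[F] F), GradedDual3 F gr f →
      ∃ k : ℕ, 0 < k ∧ WeakCoassoc F Δ Δ f k)
    (hskew : ∀ (k : ℤ) (v : V),
      (Function.support fun j : ℕ =>
          ((-1 : F) ^ (k + j + 1) * (Nat.factorial j : F)⁻¹) •
            Δ (k + j) (((cRight F c ∘ₗ Δ (-2)) ^ j) v)).Finite ∧
      (TensorProduct.comm F V V) (Δ k v) =
        ∑ᶠ j : ℕ, ((-1 : F) ^ (k + j + 1) * (Nat.factorial j : F)⁻¹) •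
          Δ (k + j) (((cRight F c ∘ₗ Δ (-2)) ^ j) v)) :
    JacobiId F Δ Δ := by
  obtain ⟨c₀, hc₀, hc⟩ := exists_weight_zero_part hgr.1 c
  have hleft := cLeft_weight_zero_part hsans hgr hc₀ hc
  have hright := cRight_weight_zero_part hsans hgr hskew hc₀ hc
  have hD : cRight F c ∘ₗ Δ (-2) = cRight F c₀ ∘ₗ Δ (-2) :=
    LinearMap.ext fun v => (hright (-2) v).symm
  have hskew₀ : SkewSymmetry F Δ c₀ := by
    rw [hD] at hskew
    exact hskew
  refine hskew₀.jacobiId ?_ hgr hwassoc hc₀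
  simpa only [IsVertexCoalgSansJacobi, hleft, hright] using hsans
end
end
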